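/- Let H_1, H_2 be hyperplanes of T, and let a, b ∈ V' with r·a ∉ H_1 and r·b ∉ H_2, such that C(H_1,a) and C(H_2,b) are distinct classes (i.e., C(H_1,a) ≠ C(H_2,b)). Then the vertices [a] and [b] have exactly q^{4e-2} + q^{4e-3} − q^{4e-4} − q^{4e-5} − q^{2e-2} + q^{2e-3} common neighbours in the graph X(2e,K). -/

import Mathlib

open Matrix

/-- The symplectic form `a M bᵀ` where `M = [[0, Iₑ],[-Iₑ, 0]]`. -/
def sympForm (K : Type) [CommRing K] (e : ℕ) (a b : Fin e ⊕ Fin e → K) : K :=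
  a ⬝ᵥ ((Matrix.fromBlocks (0 : Matrix (Fin e) (Fin e) K) 1 (-1) 0) *ᵥ b)

/-- `V'`: the set of 2e-tuples over `K` having at least one unit entry. -/
def unitTuples (K : Type) [CommRing K] (e : ℕ) : Set (Fin e ⊕ Fin e → K) :=
  {a | ∃ i, IsUnit (a i)}

/-- The equivalence class `[a]` of a tuple under unit scaling. -/
def cls (K : Type) [CommRing K] (e : ℕ) (a : Fin e ⊕ Fin e → K) :
    Set (Fin e ⊕ Fin e → K) :=
  {b | ∃ σ : Kˣ, b = σ • a}

/-- `V`: the set of equivalence classes of elements of `V'` under unit scaling. -/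
def classes (K : Type) [CommRing K] (e : ℕ) : Set (Set (Fin e ⊕ Fin e → K)) :=
  {S | ∃ a ∈ unitTuples K e, S = cls K e a}

/-- Adjacency in the graph `X(2e,K)`: `a M bᵀ ∈ K \ {0}`. -/
def adjX (K : Type) [CommRing K] (e : ℕ) (A B : Set (Fin e ⊕ Fin e → K)) : Prop :=
  ∃ a ∈ A, ∃ b ∈ B, sympForm K e a b ≠ 0

/-- Adjacency in the complement of `X(2e,K)`: distinct classes with `a M bᵀ = 0`. -/
def adjXc (K : Type) [CommRing K] (e : ℕ) (A B : Set (Fin e ⊕ Fin e → K)) : Prop :=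
  A ≠ B ∧ ∃ a ∈ A, ∃ b ∈ B, sympForm K e a b = 0

/-- Adjacency in the graph `Y(2e,K)`: `a M bᵀ ∈ J \ {0}`. -/
def adjY (K : Type) [CommRing K] (J : Ideal K) (e : ℕ)
    (A B : Set (Fin e ⊕ Fin e → K)) : Prop :=
  ∃ a ∈ A, ∃ b ∈ B, sympForm K e a b ∈ J ∧ sympForm K e a b ≠ 0

/-- `T = J × ⋯ × J` (2e factors), as a subset of `K^{2e}`. -/
def Tset (K : Type) [CommRing K] (J : Ideal K) (e : ℕ) : Set (Fin e ⊕ Fin e → K) :=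
  {x | ∀ i, x i ∈ J}

/-- A hyperplane of `T`: a `K`-submodule contained in `T` of cardinality `q^(2e-1)`. -/
def IsHyperplane (K : Type) [CommRing K] (J : Ideal K) (e q : ℕ)
    (H : Submodule K (Fin e ⊕ Fin e → K)) : Prop :=
  (H : Set (Fin e ⊕ Fin e → K)) ⊆ Tset K J e ∧ Nat.card H = q ^ (2 * e - 1)

/-- `C(H,u) = {[u+h] : h ∈ H}`. -/
def classSet (K : Type) [CommRing K] (e : ℕ) (H : Submodule K (Fin e ⊕ Fin e → K))
    (u : Fin e ⊕ Fin e → K) : Set (Set (Fin e ⊕ Fin e → K)) :=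
  {S | ∃ h ∈ (H : Set (Fin e ⊕ Fin e → K)), S = cls K e (u + h)}

/-- The set of tuples `{σ • (u+h) : σ ∈ Kˣ, h ∈ H}`. -/
def orbitSet (K : Type) [CommRing K] (e : ℕ) (H : Submodule K (Fin e ⊕ Fin e → K))
    (u : Fin e ⊕ Fin e → K) : Set (Fin e ⊕ Fin e → K) :=
  {x | ∃ σ : Kˣ, ∃ h ∈ (H : Set (Fin e ⊕ Fin e → K)), x = σ • (u + h)}

/-- The coset `c • u + T` of `T`. -/
def cosetOf (K : Type) [CommRing K] (J : Ideal K) (e : ℕ) (c : K)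
    (u : Fin e ⊕ Fin e → K) : Set (Fin e ⊕ Fin e → K) :=
  {x | ∃ t ∈ Tset K J e, x = c • u + t}

/-- A surjective homomorphism of finite additive groups has fibres of equal size. -/
theorem card_preimage_mul_card {G H : Type*} [AddCommGroup G] [AddCommGroup H] [Finite G]
    [Finite H] (f : G →+ H) (hf : Function.Surjective f) (S : Set H) :
    Nat.card {x // f x ∈ S} * Nat.card H = Nat.card G * Nat.card S := by
  classical
  have key : ∀ S : Set H, Nat.card {x // f x ∈ S} = Nat.card S * Nat.card f.ker := by
    intro S
    have := Fintype.ofFinite S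
    let g : {x // f x ∈ S} → S := fun x => ⟨f x.1, x.2⟩
    rw [← Nat.card_congr (Equiv.sigmaFiberEquiv g), Nat.card_sigma]
    rw [Finset.sum_congr rfl (g := fun _ => Nat.card f.ker)]
    · simp
    · rintro ⟨s, hs⟩ -
      obtain ⟨y, rfl⟩ := hf s
      refine Nat.card_congr ⟨fun x => ⟨x.1.1 - y, ?_⟩,
        fun k => ⟨⟨k.1 + y, ?_⟩, ?_⟩, fun x => ?_, fun k => ?_⟩
      · have := x.2
        simp only [g, Subtype.mk.injEq] at this
        simp [AddMonoidHom.mem_ker, this]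
      · have := k.2
        rw [AddMonoidHom.mem_ker] at this
        simpa [this] using hs
      · have := k.2
        rw [AddMonoidHom.mem_ker] at this
        simp [g, this]
      · simp
      · simp
  have h := key Set.univ
  have h' : Nat.card {x // f x ∈ (Set.univ : Set H)} = Nat.card G :=
    Nat.card_congr (Equiv.subtypeUnivEquiv (by simp))
  rw [key S, ← h', h, Nat.card_univ]
  ring

theorem card_ne_zero_and_ne_zero (P : Type*) [Zero P] [Finite P] :
    Nat.card {p : P × P | p.1 ≠ 0 ∧ p.2 ≠ 0} = (Nat.card P - 1) ^ 2 := by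
  classical
  have := Fintype.ofFinite P
  have h : Nat.card {x : P // x ≠ 0} = Nat.card P - 1 := by
    simp [Nat.card_eq_fintype_card, Fintype.card_subtype_compl]
  rw [sq, ← h, ← Nat.card_prod]
  exact Nat.card_congr (Equiv.subtypeProdEquivProd (p := fun x : P => x ≠ 0)
    (q := fun x : P => x ≠ 0))

/-- Counting vectors on which two linear forms with an invertible `2 × 2` minor are both
nonzero. -/
theorem card_forms_ne_zero {K ι P : Type*} [CommRing K] [Fintype ι] [DecidableEq ι]
    [AddCommGroup P] [Module K P] [Finite P] (v w : ι → K) (i j : ι)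
    (hu : IsUnit (v i * w j - v j * w i)) :
    Nat.card {x : ι → P // ∑ k, v k • x k ≠ 0 ∧ ∑ k, w k • x k ≠ 0} * Nat.card P ^ 2 =
      Nat.card P ^ Fintype.card ι * (Nat.card P - 1) ^ 2 := by
  let L : (ι → K) → (ι → P) →ₗ[K] P := fun v => ∑ k, v k • LinearMap.proj k
  have hL : ∀ v x, L v x = ∑ k, v k • x k := by simp [L]
  have hs : ∀ (v : ι → K) (k : ι) (p : P), L v (Pi.single k p) = v k • p := by
    intro v k p
    rw [hL, Finset.sum_eq_single k] <;> simp +contextual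
  have hsurj : Function.Surjective ((L v).prod (L w)).toAddMonoidHom := by
    rintro ⟨s, t⟩
    obtain ⟨u, hu⟩ := hu
    have hu' : (↑u⁻¹ : K) * (v i * w j - v j * w i) = 1 := by rw [← hu]; simp
    refine ⟨(↑u⁻¹ : K) • (Pi.single i (w j • s - v j • t) + Pi.single j (v i • t - w i • s)), ?_⟩
    simp only [LinearMap.toAddMonoidHom_coe, LinearMap.prod_apply, Function.prod_apply, map_smul,
      map_add, hs, Prod.ext_iff, Prod.smul_fst, Prod.smul_snd, Prod.fst_add, Prod.snd_add]
    constructor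
    · linear_combination (norm := module) hu' • s
    · linear_combination (norm := module) hu' • t
  have := card_preimage_mul_card _ hsurj {p : P × P | p.1 ≠ 0 ∧ p.2 ≠ 0}
  rw [card_ne_zero_and_ne_zero, Nat.card_prod, Nat.card_fun, ← sq, Nat.card_eq_fintype_card (α := ι)]
    at this
  rw [← this]
  simp [hL]

section Ring

variable {K : Type} [CommRing K] {J : Ideal K} {r : K}

theorem isUnit_iff_notMem_of_unique_ideal (hJtop : J ≠ ⊤)
    (hideals : ∀ I : Ideal K, I = ⊥ ∨ I = J ∨ I = ⊤) (x : K) : IsUnit x ↔ x ∉ J := by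
  constructor
  · exact fun hx hxJ => hJtop (Ideal.eq_top_of_isUnit_mem _ hxJ hx)
  · intro hx
    have hmem : x ∈ Ideal.span {x} := Ideal.mem_span_singleton_self x
    rcases hideals (Ideal.span {x}) with h | h | h
    · rw [h, Ideal.mem_bot] at hmem
      exact absurd (hmem ▸ J.zero_mem) hx
    · exact absurd (h ▸ hmem) hx
    · exact Ideal.span_singleton_eq_top.1 h

theorem isUnit_one_add_of_mem (hJtop : J ≠ ⊤)
    (hideals : ∀ I : Ideal K, I = ⊥ ∨ I = J ∨ I = ⊤) {x : K} (hx : x ∈ J) : IsUnit (1 + x) := by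
  rw [isUnit_iff_notMem_of_unique_ideal hJtop hideals]
  intro h
  exact hJtop ((Ideal.eq_top_iff_one _).2 (by simpa using J.sub_mem h hx))

theorem mul_generator_eq_zero_iff (hJr : J = Ideal.span {r}) (hJbot : J ≠ ⊥) (hJtop : J ≠ ⊤)
    (hideals : ∀ I : Ideal K, I = ⊥ ∨ I = J ∨ I = ⊤) (x : K) : x * r = 0 ↔ x ∈ J := by
  have hr0 : r ≠ 0 := by
    rintro rfl
    exact hJbot (by simpa using hJr)
  have hrJ : r ∈ J := hJr ▸ Ideal.mem_span_singleton_self r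
  have hrr : r * r = 0 := by
    have hmem : r * r ∈ Ideal.span {r * r} := Ideal.mem_span_singleton_self _
    rcases hideals (Ideal.span {r * r}) with h | h | h
    · simpa [h] using hmem
    · exfalso
      obtain ⟨c, hc⟩ := Ideal.mem_span_singleton'.1 (h ▸ hrJ : r ∈ Ideal.span {r * r})
      have hu := isUnit_one_add_of_mem hJtop hideals (J.mul_mem_left (-c) hrJ)
      exact hr0 (hu.mul_right_eq_zero.1 (by linear_combination -hc))
    · have := Ideal.span_singleton_eq_top.1 h
      exact absurd (J.mul_mem_left r hrJ)
        ((isUnit_iff_notMem_of_unique_ideal hJtop hideals _).1 this)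
  constructor
  · intro hx
    by_contra hxJ
    exact hr0 (((isUnit_iff_notMem_of_unique_ideal hJtop hideals x).2 hxJ).mul_right_eq_zero.1 hx)
  · rw [hJr]
    intro hx
    obtain ⟨c, rfl⟩ := Ideal.mem_span_singleton'.1 hx
    rw [mul_assoc, hrr, mul_zero]

theorem card_ideal_eq_card_quotient [Finite K] (hJr : J = Ideal.span {r}) (hJbot : J ≠ ⊥)
    (hJtop : J ≠ ⊤) (hideals : ∀ I : Ideal K, I = ⊥ ∨ I = J ∨ I = ⊤) :
    Nat.card J = Nat.card (K ⧸ J) := by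
  let f : K →ₗ[K] K := LinearMap.toSpanSingleton K K r
  have hker : LinearMap.ker f = J := by
    ext x
    simpa [f] using mul_generator_eq_zero_iff hJr hJbot hJtop hideals x
  have hrange : LinearMap.range f = J := by
    rw [hJr, LinearMap.range_toSpanSingleton]
  have h := Nat.card_congr f.quotKerEquivRange.toEquiv
  rw [hker, hrange] at h
  exact h.symm

theorem card_units_add_card_ideal [Finite K] (hJtop : J ≠ ⊤)
    (hideals : ∀ I : Ideal K, I = ⊥ ∨ I = J ∨ I = ⊤) :
    Nat.card Kˣ + Nat.card J = Nat.card K := by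
  classical
  have h : Nat.card Kˣ = Nat.card {x : K // x ∉ J} := by
    refine Nat.card_congr (Equiv.ofBijective
      (fun u => ⟨u, (isUnit_iff_notMem_of_unique_ideal hJtop hideals _).1 u.isUnit⟩) ⟨?_, ?_⟩)
    · intro u v huv
      exact Units.ext (congrArg Subtype.val huv)
    · rintro ⟨x, hx⟩
      obtain ⟨u, rfl⟩ := (isUnit_iff_notMem_of_unique_ideal hJtop hideals x).2 hx
      exact ⟨u, rfl⟩
  rw [h, add_comm, ← Nat.card_congr (Equiv.sumCompl (· ∈ J)), Nat.card_sum]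

end Ring

section Classes

variable {K : Type} [CommRing K] {e : ℕ}

theorem sympForm_eq (x a : Fin e ⊕ Fin e → K) :
    sympForm K e x a = ∑ k, Sum.elim (fun i => a (.inr i)) (fun i => -a (.inl i)) k • x k := by
  simp only [sympForm, Matrix.fromBlocks_mulVec, dotProduct, Fintype.sum_sum_type, Sum.elim_inl,
    Sum.elim_inr]
  simp [Matrix.neg_mulVec, mul_comm, Function.comp_def]

theorem sympForm_smul_smul (σ τ : K) (x a : Fin e ⊕ Fin e → K) :
    sympForm K e (σ • x) (τ • a) = σ * τ * sympForm K e x a := by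
  simp only [sympForm, Matrix.mulVec_smul, smul_dotProduct, dotProduct_smul, smul_eq_mul]
  ring

theorem cls_smul (σ : Kˣ) (a : Fin e ⊕ Fin e → K) : cls K e (σ • a) = cls K e a := by
  ext b
  constructor
  · rintro ⟨τ, rfl⟩
    exact ⟨τ * σ, by rw [mul_smul]⟩
  · rintro ⟨τ, rfl⟩
    exact ⟨τ * σ⁻¹, by rw [← mul_smul]; simp⟩

theorem mem_cls_self (a : Fin e ⊕ Fin e → K) : a ∈ cls K e a := ⟨1, by simp⟩

theorem adjX_cls_iff (x a : Fin e ⊕ Fin e → K) :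
    adjX K e (cls K e x) (cls K e a) ↔ sympForm K e x a ≠ 0 := by
  constructor
  · rintro ⟨_, ⟨σ, rfl⟩, _, ⟨τ, rfl⟩, h⟩ h0
    rw [Units.smul_def, Units.smul_def, sympForm_smul_smul, h0, mul_zero] at h
    exact h rfl
  · exact fun h => ⟨x, mem_cls_self x, a, mem_cls_self a, h⟩

theorem smul_mem_unitTuples {x : Fin e ⊕ Fin e → K} (hx : x ∈ unitTuples K e) (σ : Kˣ) :
    σ • x ∈ unitTuples K e := by
  obtain ⟨i, hi⟩ := hx
  exact ⟨i, σ.isUnit.mul hi⟩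

theorem smul_injective_of_mem_unitTuples {x : Fin e ⊕ Fin e → K} (hx : x ∈ unitTuples K e) :
    Function.Injective fun σ : Kˣ => σ • x := by
  obtain ⟨i, hi⟩ := hx
  intro σ τ h
  have := congrFun h i
  exact Units.ext (hi.mul_left_injective this)

/-- Every class of unit tuples consists of `|Kˣ|` tuples. -/
theorem card_classes_mul_card_units [Finite K] (P : Set (Fin e ⊕ Fin e → K) → Prop) :
    Nat.card {C ∈ classes K e | P C} * Nat.card Kˣ =
      Nat.card {x : Fin e ⊕ Fin e → K // x ∈ unitTuples K e ∧ P (cls K e x)} := by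
  classical
  have := Fintype.ofFinite {C ∈ classes K e | P C}
  let g : {x : Fin e ⊕ Fin e → K // x ∈ unitTuples K e ∧ P (cls K e x)} →
      {C ∈ classes K e | P C} := fun x => ⟨cls K e x.1, ⟨x.1, x.2.1, rfl⟩, x.2.2⟩
  rw [← Nat.card_congr (Equiv.sigmaFiberEquiv g), Nat.card_sigma,
    Finset.sum_congr rfl (g := fun _ => Nat.card Kˣ)]
  · simp
  · rintro ⟨_, ⟨y, hy, rfl⟩, hP⟩ -
    refine (Nat.card_congr (Equiv.ofBijective (fun σ : Kˣ =>
      ⟨⟨σ • y, smul_mem_unitTuples hy σ, by rwa [cls_smul]⟩,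
        Subtype.ext (cls_smul σ y)⟩) ⟨?_, ?_⟩)).symm
    · intro σ τ h
      exact smul_injective_of_mem_unitTuples hy (congrArg (fun z => z.1.1) h)
    · rintro ⟨⟨x, hx⟩, h⟩
      have hxy : cls K e x = cls K e y := congrArg Subtype.val h
      obtain ⟨σ, hσ⟩ : x ∈ cls K e y := hxy ▸ mem_cls_self x
      exact ⟨σ, Subtype.ext (Subtype.ext hσ.symm)⟩

variable {J : Ideal K} {r : K} {q : ℕ}

/-- The class `C(H,u)` does not depend on the hyperplane `H`. -/
theorem classSet_eq [Finite K] (hJr : J = Ideal.span {r}) (hJbot : J ≠ ⊥) (hJtop : J ≠ ⊤)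
    (hideals : ∀ I : Ideal K, I = ⊥ ∨ I = J ∨ I = ⊤) (hcard : Nat.card J = q) (he : e ≠ 0)
    {H : Submodule K (Fin e ⊕ Fin e → K)} (hH : IsHyperplane K J e q H)
    {u : Fin e ⊕ Fin e → K} (hu : r • u ∉ H) :
    classSet K e H u = {S | ∃ x, (∀ i, x i - u i ∈ J) ∧ S = cls K e x} := by
  classical
  let f : H × J → {t : Fin e ⊕ Fin e → K // ∀ i, t i ∈ J} := fun p =>
    ⟨p.1.1 + p.2.1 • u, fun i => J.add_mem (hH.1 p.1.2 i) (J.mul_mem_right _ p.2.2)⟩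
  have hinj : Function.Injective f := by
    rintro ⟨⟨h, hh⟩, ⟨j, hj⟩⟩ ⟨⟨h', hh'⟩, ⟨j', hj'⟩⟩ heq
    have heq : h + j • u = h' + j' • u := congrArg Subtype.val heq
    have hd : j - j' ∈ J := J.sub_mem hj hj'
    rw [hJr] at hd
    obtain ⟨z, hz⟩ := Ideal.mem_span_singleton'.1 hd
    have hmem : z • r • u ∈ H := by
      have : z • r • u = h' - h := by
        rw [smul_smul, hz, sub_smul]
        linear_combination heq
      exact this ▸ H.sub_mem hh' hh
    have hzJ : z ∈ J := by
      by_contra hzJ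
      obtain ⟨w, rfl⟩ := (isUnit_iff_notMem_of_unique_ideal hJtop hideals z).2 hzJ
      have := H.smul_mem (↑w⁻¹ : K) hmem
      rw [smul_smul, Units.inv_mul, one_smul] at this
      exact hu this
    rw [(mul_generator_eq_zero_iff hJr hJbot hJtop hideals z).2 hzJ] at hz
    obtain rfl : j = j' := (sub_eq_zero.1 hz.symm)
    obtain rfl : h = h' := add_right_cancel heq
    rfl
  have hsurj : Function.Surjective f := by
    refine ((Nat.bijective_iff_injective_and_card f).2 ⟨hinj, ?_⟩).2
    rw [Nat.card_prod, hH.2, hcard, Nat.card_congr Equiv.subtypePiEquivPi, Nat.card_pi]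
    simp only [hcard, Finset.prod_const, Finset.card_univ, Fintype.card_sum,
      Fintype.card_fin]
    rw [← pow_succ]
    congr 1
    omega
  ext S
  constructor
  · rintro ⟨h, hh, rfl⟩
    exact ⟨u + h, fun i => by simpa using hH.1 hh i, rfl⟩
  · rintro ⟨x, hx, rfl⟩
    obtain ⟨⟨⟨h, hh⟩, ⟨j, hj⟩⟩, hhj⟩ := hsurj ⟨x - u, hx⟩
    have hhj : h + j • u = x - u := congrArg Subtype.val hhj
    obtain ⟨w, hw⟩ := isUnit_one_add_of_mem hJtop hideals hj
    refine ⟨(↑w⁻¹ : K) • h, H.smul_mem _ hh, ?_⟩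
    rw [← cls_smul w (u + _)]
    congr 1
    rw [Units.smul_def, smul_add, smul_smul, Units.mul_inv, one_smul, hw, add_smul, one_smul]
    linear_combination -hhj

theorem congruentClasses_subset (σ : Kˣ) {a b : Fin e ⊕ Fin e → K}
    (h : ∀ i, b i - σ * a i ∈ J) :
    {S | ∃ x, (∀ i, x i - b i ∈ J) ∧ S = cls K e x} ⊆
      {S | ∃ x, (∀ i, x i - a i ∈ J) ∧ S = cls K e x} := by
  rintro _ ⟨x, hx, rfl⟩
  refine ⟨σ⁻¹ • x, fun i => ?_, (cls_smul _ _).symm⟩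
  have := J.mul_mem_left (↑σ⁻¹ : K) (J.add_mem (hx i) (h i))
  convert this using 1
  simp only [Pi.smul_apply, Units.smul_def, smul_eq_mul]
  linear_combination a i * σ.inv_mul

/-- Two unit tuples have an invertible minor unless they are proportional modulo `J`. -/
theorem exists_isUnit_minor_or_congruent (hJtop : J ≠ ⊤)
    (hideals : ∀ I : Ideal K, I = ⊥ ∨ I = J ∨ I = ⊤) {a b : Fin e ⊕ Fin e → K}
    (ha : a ∈ unitTuples K e) (hb : b ∈ unitTuples K e) :
    (∃ i j, IsUnit (a i * b j - a j * b i)) ∨ ∃ σ : Kˣ, ∀ i, b i - σ * a i ∈ J := by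
  have hunit := isUnit_iff_notMem_of_unique_ideal hJtop hideals
  rw [or_iff_not_imp_left]
  intro hminor
  obtain ⟨i, u, hu⟩ := ha
  have hmem : ∀ j, b j - ↑u⁻¹ * b i * a j ∈ J := by
    intro j
    have : a i * b j - a j * b i ∈ J := by
      by_contra h
      exact hminor ⟨i, j, (hunit _).2 h⟩
    convert J.mul_mem_left (↑u⁻¹ : K) this using 1
    rw [← hu]
    linear_combination -(b j) * u.inv_mul
  have hσ : IsUnit (↑u⁻¹ * b i) := by
    rw [hunit]
    intro h
    obtain ⟨j, hj⟩ := hb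
    exact (hunit _).1 hj (by simpa using J.add_mem (hmem j) (J.mul_mem_right (a j) h))
  obtain ⟨σ, hσ⟩ := hσ
  exact ⟨σ, fun j => hσ ▸ hmem j⟩

theorem exists_isUnit_dual_minor {a b : Fin e ⊕ Fin e → K}
    (h : ∃ i j, IsUnit (a i * b j - a j * b i)) :
    ∃ i j, IsUnit
      (Sum.elim (fun i => a (.inr i)) (fun i => -a (.inl i)) i *
          Sum.elim (fun i => b (.inr i)) (fun i => -b (.inl i)) j -
        Sum.elim (fun i => a (.inr i)) (fun i => -a (.inl i)) j *
          Sum.elim (fun i => b (.inr i)) (fun i => -b (.inl i)) i) := by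
  obtain ⟨i, j, h⟩ := h
  refine ⟨i.swap, j.swap, ?_⟩
  rcases i with i | i <;> rcases j with j | j <;>
    simp only [Sum.swap_inl, Sum.swap_inr, Sum.elim_inl, Sum.elim_inr] <;>
    first
    | exact h
    | (convert h using 1; ring1)
    | (convert h.neg using 1; ring1)

/-- The number of unit tuples that are orthogonal to neither of two tuples which are not
proportional modulo `J`. -/
theorem card_unitTuples_sympForm_ne_zero [Finite K] (hJtop : J ≠ ⊤)
    (hideals : ∀ I : Ideal K, I = ⊥ ∨ I = J ∨ I = ⊤) (hJ : Nat.card J = q)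
    (hK : Nat.card K = q ^ 2) (hq : 0 < q) (he : 2 ≤ e) {a b : Fin e ⊕ Fin e → K}
    (h : ∃ i j, IsUnit (a i * b j - a j * b i)) :
    Nat.card {x // x ∈ unitTuples K e ∧ sympForm K e x a ≠ 0 ∧ sympForm K e x b ≠ 0} +
        q ^ (2 * e - 2) * (q - 1) ^ 2 =
      q ^ (4 * e - 4) * (q ^ 2 - 1) ^ 2 := by
  classical
  obtain ⟨i, j, hu⟩ := exists_isUnit_dual_minor h
  have hcK := card_forms_ne_zero (P := K) _ _ i j hu
  have hcJ := card_forms_ne_zero (P := J) _ _ i j hu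
  rw [hK] at hcK
  rw [hJ] at hcJ
  simp only [← sympForm_eq] at hcK
  simp only [Fintype.card_sum, Fintype.card_fin] at hcK hcJ
  set Q : (Fin e ⊕ Fin e → K) → Prop :=
    fun x => sympForm K e x a ≠ 0 ∧ sympForm K e x b ≠ 0 with hQ
  have hB : Nat.card {x : {x // Q x} // x.1 ∉ unitTuples K e} * q ^ 2 =
      q ^ (e + e) * (q - 1) ^ 2 := by
    rw [← hcJ]
    congr 1
    have hmem : ∀ x : Fin e ⊕ Fin e → K, x ∉ unitTuples K e ↔ ∀ k, x k ∈ J := by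
      simp [unitTuples, isUnit_iff_notMem_of_unique_ideal hJtop hideals]
    have hval : ∀ (c : Fin e ⊕ Fin e → K) (x : Fin e ⊕ Fin e → J),
        sympForm K e (fun k => (x k : K)) c ≠ 0 ↔
          ∑ k, Sum.elim (fun i => c (.inr i)) (fun i => -c (.inl i)) k • x k ≠ 0 := by
      intro c x
      rw [sympForm_eq, not_iff_not, ← Subtype.coe_inj]
      simp
    refine Nat.card_congr ⟨fun x => ⟨fun k => ⟨x.1.1 k, (hmem _).1 x.2 k⟩, ?_⟩,
      fun x => ⟨⟨fun k => x.1 k, ?_⟩, (hmem _).2 fun k => (x.1 k).2⟩, fun x => rfl, fun x => rfl⟩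
    · exact ⟨(hval a _).1 x.1.2.1, (hval b _).1 x.1.2.2⟩
    · exact ⟨(hval a _).2 x.2.1, (hval b _).2 x.2.2⟩
  have hA : Nat.card {x // x ∈ unitTuples K e ∧ Q x} =
      Nat.card {x : {x // Q x} // x.1 ∈ unitTuples K e} :=
    Nat.card_congr ((Equiv.subtypeEquivRight fun x => and_comm).trans
      (Equiv.subtypeSubtypeEquivSubtypeInter Q (· ∈ unitTuples K e)).symm)
  have hsum : Nat.card {x : {x // Q x} // x.1 ∈ unitTuples K e} +
      Nat.card {x : {x // Q x} // x.1 ∉ unitTuples K e} = Nat.card {x // Q x} := by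
    rw [← Nat.card_sum]
    exact Nat.card_congr (Equiv.sumCompl fun x : {x // Q x} => x.1 ∈ unitTuples K e)
  have hB' : Nat.card {x : {x // Q x} // x.1 ∉ unitTuples K e} =
      q ^ (2 * e - 2) * (q - 1) ^ 2 := by
    apply Nat.eq_of_mul_eq_mul_right (pow_pos hq 2)
    rw [hB, mul_right_comm, ← pow_add]
    congr 2
    omega
  have hC : Nat.card {x // Q x} = q ^ (4 * e - 4) * (q ^ 2 - 1) ^ 2 := by
    apply Nat.eq_of_mul_eq_mul_right (pow_pos hq 4)
    rw [mul_right_comm, ← pow_add, show 4 * e - 4 + 4 = 2 * (e + e) by omega, pow_mul, ← hcK]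
    ring
  rw [hA, ← hB', hsum, hC]

end Classes

theorem eq_of_mul_card_units {q e n N u : ℕ} (hq : 2 ≤ q) (he : 2 ≤ e)
    (hu : u + q = q ^ 2) (hn : n * u = N)
    (hN : N + q ^ (2 * e - 2) * (q - 1) ^ 2 = q ^ (4 * e - 4) * (q ^ 2 - 1) ^ 2) :
    n = q ^ (4 * e - 2) + q ^ (4 * e - 3) - q ^ (4 * e - 4) - q ^ (4 * e - 5)
        - q ^ (2 * e - 2) + q ^ (2 * e - 3) := by
  obtain ⟨k, rfl⟩ := Nat.exists_eq_add_of_le' he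
  rw [show 4 * (k + 2) - 2 = 4 * k + 6 by omega, show 4 * (k + 2) - 3 = 4 * k + 5 by omega,
    show 4 * (k + 2) - 4 = 4 * k + 4 by omega, show 4 * (k + 2) - 5 = 4 * k + 3 by omega,
    show 2 * (k + 2) - 2 = 2 * k + 2 by omega, show 2 * (k + 2) - 3 = 2 * k + 1 by omega]
  rw [show 4 * (k + 2) - 4 = 4 * k + 4 by omega, show 2 * (k + 2) - 2 = 2 * k + 2 by omega] at hN
  have h1 : q ^ (4 * k + 4) + q ^ (4 * k + 3) ≤ q ^ (4 * k + 5) :=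
    calc q ^ (4 * k + 4) + q ^ (4 * k + 3) ≤ q ^ (4 * k + 4) + q ^ (4 * k + 4) := by
          gcongr <;> omega
      _ = 2 * q ^ (4 * k + 4) := by ring
      _ ≤ q * q ^ (4 * k + 4) := by gcongr
      _ = q ^ (4 * k + 5) := by ring
  have h2 : q ^ (2 * k + 2) ≤ q ^ (4 * k + 6) := Nat.pow_le_pow_right (by omega) (by omega)
  have hsub : q ^ (4 * k + 6) + q ^ (4 * k + 5) - q ^ (4 * k + 4) - q ^ (4 * k + 3)
        - q ^ (2 * k + 2) + q ^ (2 * k + 1) + (q ^ (4 * k + 4) + q ^ (4 * k + 3) + q ^ (2 * k + 2)) =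
      q ^ (4 * k + 6) + q ^ (4 * k + 5) + q ^ (2 * k + 1) := by omega
  refine Nat.add_right_cancel (m := q ^ (4 * k + 4) + q ^ (4 * k + 3) + q ^ (2 * k + 2)) ?_
  rw [hsub]
  obtain ⟨p, rfl⟩ := Nat.exists_eq_add_of_le' (show 1 ≤ q by omega)
  have hu' : u = p * (p + 1) := by
    apply Nat.add_right_cancel (m := p + 1)
    rw [hu]
    ring
  have hp : p * (p + 1) ≠ 0 := by
    have : p ≠ 0 := by omega
    positivity
  rw [Nat.add_sub_cancel, show (p + 1) ^ 2 - 1 = p * (p + 2) by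
    rw [Nat.sub_eq_iff_eq_add (Nat.one_le_pow _ _ (by omega))]; ring, ← hn, hu'] at hN
  apply Nat.eq_of_mul_eq_mul_right (Nat.pos_of_ne_zero hp)
  zify at hN ⊢
  linear_combination hN

/-- Corollary: two vertices from different classes of the partition have
`q^(4e-2) + q^(4e-3) - q^(4e-4) - q^(4e-5) - q^(2e-2) + q^(2e-3)` common
neighbours in `X(2e,K)`. -/
theorem common_neighbours_X_different_classes
    (K : Type) [CommRing K] [Fintype K]
    (J : Ideal K) (r : K) (q : ℕ)
    (hJr : J = Ideal.span {r})
    (hJbot : J ≠ ⊥) (hJtop : J ≠ ⊤)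
    (hideals : ∀ I : Ideal K, I = ⊥ ∨ I = J ∨ I = ⊤)
    (hq : IsPrimePow q)
    (hqcard : Nat.card (K ⧸ J) = q)
    (e : ℕ) (he : 2 ≤ e)
    (H₁ H₂ : Submodule K (Fin e ⊕ Fin e → K))
    (hH₁ : IsHyperplane K J e q H₁) (hH₂ : IsHyperplane K J e q H₂)
    (a b : Fin e ⊕ Fin e → K)
    (ha : a ∈ unitTuples K e) (hb : b ∈ unitTuples K e)
    (hra : r • a ∉ H₁) (hrb : r • b ∉ H₂)
    (hCC : classSet K e H₁ a ≠ classSet K e H₂ b) :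
    Nat.card ↥{C ∈ classes K e | adjX K e C (cls K e a) ∧ adjX K e C (cls K e b)} =
      q ^ (4 * e - 2) + q ^ (4 * e - 3) - q ^ (4 * e - 4) - q ^ (4 * e - 5)
        - q ^ (2 * e - 2) + q ^ (2 * e - 3) := by
  have hJ : Nat.card J = q := (card_ideal_eq_card_quotient hJr hJbot hJtop hideals).trans hqcard
  have hK : Nat.card K = q ^ 2 := by
    rw [Submodule.card_eq_card_quotient_mul_card J, hqcard, hJ, sq]
  have hminor : ∃ i j, IsUnit (a i * b j - a j * b i) := by
    refine (exists_isUnit_minor_or_congruent hJtop hideals ha hb).resolve_right ?_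
    rintro ⟨σ, hσ⟩
    apply hCC
    rw [classSet_eq hJr hJbot hJtop hideals hJ (by omega) hH₁ hra,
      classSet_eq hJr hJbot hJtop hideals hJ (by omega) hH₂ hrb]
    refine (congruentClasses_subset σ⁻¹ fun i => ?_).antisymm (congruentClasses_subset σ hσ)
    convert J.mul_mem_left (-(↑σ⁻¹ : K)) (hσ i) using 1
    linear_combination -(a i) * σ.inv_mul
  have hn := card_classes_mul_card_units (K := K) (e := e)
    fun C => adjX K e C (cls K e a) ∧ adjX K e C (cls K e b)
  simp only [adjX_cls_iff] at hn
  refine eq_of_mul_card_units hq.two_le he ?_ hn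
    (card_unitTuples_sympForm_ne_zero hJtop hideals hJ hK hq.pos he hminor)
  rw [← hK, ← card_units_add_card_ideal hJtop hideals, hJ]
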